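/- Poly-logarithmic residual degree after O(log log Δ) blocks (Corollary 2). Let n ≥ 3 and let G be a finite simple graph on n vertices with maximum degree Δ ≥ 4. Then with probability at least 1 − n^{−7} over the uniformly random ordering, there exists an index i ≤ ⌈log₂ log₂ Δ⌉ + 2 such that Δ_i ≤ max(5000·(ln n)², (ln n)^4); in particular, the maximum degree of the residual graph becomes poly-logarithmic in n within O(log log Δ) blocks. -/

import Mathlib

open Finset
open scoped Classical

/-- The closed neighborhood of `v` as a `Finset`. -/
def closedNbhd {V : Type*} [Fintype V] [DecidableEq V] (G : SimpleGraph V)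
    [DecidableRel G.Adj] (v : V) : Finset V :=
  insert v (G.neighborFinset v)

/-- One pass of the sequential greedy MIS process over a list of vertices, carrying
the pair `(I, U)` of the current independent set and the current uncovered set. -/
def greedyStep {V : Type*} [Fintype V] [DecidableEq V] (G : SimpleGraph V)
    [DecidableRel G.Adj] : Finset V × Finset V → List V → Finset V × Finset V
  | p, [] => p
  | p, v :: rest =>
      greedyStep G (if v ∈ p.2 then (insert v p.1, p.2 \ closedNbhd G v) else p) rest

/-- `greedyU G σ t` is `U_t`: the set of uncovered vertices at the beginning of
iteration `t` (i.e. after the greedy process has handled `v_1, …, v_{t-1}`). -/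
def greedyU {V : Type*} [Fintype V] [DecidableEq V] (G : SimpleGraph V)
    [DecidableRel G.Adj] {n : ℕ} (σ : Fin n ≃ V) (t : ℕ) : Finset V :=
  (greedyStep G (∅, Finset.univ) ((List.ofFn ⇑σ).take (t - 1))).2

/-- Maximum degree of the subgraph of `G` induced by the vertex set `S`. -/
def maxDegOn {V : Type*} [Fintype V] [DecidableEq V] (G : SimpleGraph V)
    [DecidableRel G.Adj] (S : Finset V) : ℕ :=
  S.sup fun v => (G.neighborFinset v ∩ S).card

/-- `blockK G σ i` is `k_i`, the number of vertices processed after `i` blocks of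
the simulated greedy process (with parameter `C = 5`): `k_0 = 0` and, as long as
the current residual maximum degree `Δ_i` exceeds `(ln n)^4`,
`k_i = ⌈n / (5·√Δ_i)⌉`; once `Δ_i ≤ (ln n)^4` the process stops (`k` freezes). -/
noncomputable def blockK {V : Type*} [Fintype V] [DecidableEq V] (G : SimpleGraph V)
    [DecidableRel G.Adj] {n : ℕ} (σ : Fin n ≃ V) : ℕ → ℕ
  | 0 => 0
  | i + 1 =>
      let D := maxDegOn G (greedyU G σ (blockK G σ i + 1))
      if (Real.log n) ^ 4 < (D : ℝ) then ⌈(n : ℝ) / (5 * Real.sqrt D)⌉₊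
      else blockK G σ i

/-- `blockDelta G σ i` is `Δ_i`, the maximum degree of the residual graph at the
beginning of block `i`, i.e. after greedy has processed the first `k_{i-1}`
vertices. -/
noncomputable def blockDelta {V : Type*} [Fintype V] [DecidableEq V] (G : SimpleGraph V)
    [DecidableRel G.Adj] {n : ℕ} (σ : Fin n ≃ V) (i : ℕ) : ℕ :=
  maxDegOn G (greedyU G σ (blockK G σ (i - 1) + 1))

section GreedyProcess

variable {V : Type*} [Fintype V] [DecidableEq V] (G : SimpleGraph V) [DecidableRel G.Adj] {n : ℕ}

lemma greedyStep_append (p : Finset V × Finset V) (l l' : List V) :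
    greedyStep G p (l ++ l') = greedyStep G (greedyStep G p l) l' := by
  induction l generalizing p with
  | nil => rfl
  | cons a l ih => simp only [List.cons_append, greedyStep, ih]

lemma greedyU_succ (σ : Fin n ≃ V) (s : Fin n) :
    greedyU G σ (s + 1 + 1) =
      if σ s ∈ greedyU G σ (s + 1) then greedyU G σ (s + 1) \ closedNbhd G (σ s)
      else greedyU G σ (s + 1) := by
  have h : (List.ofFn ⇑σ).take (s + 1) = (List.ofFn ⇑σ).take s ++ [σ s] := by
    rw [List.take_succ_eq_append_getElem (by simp)]
    simp
  simp only [greedyU, Nat.add_sub_cancel, h, greedyStep_append, greedyStep]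
  split_ifs <;> rfl

lemma greedyU_succ_subset (σ : Fin n ≃ V) (s : Fin n) :
    greedyU G σ (s + 1 + 1) ⊆ greedyU G σ (s + 1) := by
  rw [greedyU_succ]
  split_ifs
  · exact sdiff_subset
  · exact Subset.rfl

lemma greedyU_congr {σ τ : Fin n ≃ V} {s : ℕ} (h : ∀ j : Fin n, (j : ℕ) < s → σ j = τ j) :
    greedyU G σ (s + 1) = greedyU G τ (s + 1) := by
  have : (List.ofFn ⇑σ).take s = (List.ofFn ⇑τ).take s := by
    apply List.ext_getElem
    · simp
    · intro i h₁ h₂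
      have hi : i < s ∧ i < n := by simpa using h₁
      simpa using h ⟨i, hi.2⟩ hi.1
  simp only [greedyU, Nat.add_sub_cancel, this]

/-- Processed vertices are covered. -/
lemma apply_notMem_greedyU (σ : Fin n ≃ V) {s : ℕ} (hs : s ≤ n) (j : Fin n) (hj : (j : ℕ) < s) :
    σ j ∉ greedyU G σ (s + 1) := by
  induction s with
  | zero => omega
  | succ s ih =>
    have hsucc := greedyU_succ G σ ⟨s, hs⟩
    simp only at hsucc
    rcases Nat.lt_succ_iff_lt_or_eq.mp hj with h | h
    · exact fun hm => ih (by omega) h (greedyU_succ_subset G σ ⟨s, hs⟩ hm)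
    · obtain rfl : j = ⟨s, hs⟩ := Fin.ext h
      rw [hsucc]
      split_ifs with hm
      · simp [closedNbhd]
      · exact hm

/-- The orderings for which, after `s` steps, `v` is uncovered and has residual degree above `D`. -/
noncomputable def highDegreeOrderings (n : ℕ) (v : V) (D : ℝ) (s : ℕ) : Finset (Fin n ≃ V) :=
  univ.filter fun σ =>
    v ∈ greedyU G σ (s + 1) ∧ D < ((G.neighborFinset v ∩ greedyU G σ (s + 1)).card : ℝ)

lemma mem_highDegreeOrderings {v : V} {D : ℝ} {s : ℕ} {σ : Fin n ≃ V} :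
    σ ∈ highDegreeOrderings G n v D s ↔
      v ∈ greedyU G σ (s + 1) ∧ D < ((G.neighborFinset v ∩ greedyU G σ (s + 1)).card : ℝ) := by
  simp [highDegreeOrderings]

lemma highDegreeOrderings_succ_subset (v : V) (D : ℝ) (s : Fin n) :
    highDegreeOrderings G n v D (s + 1) ⊆ highDegreeOrderings G n v D s := by
  intro σ hσ
  rw [mem_highDegreeOrderings] at hσ ⊢
  have hU := greedyU_succ_subset G σ s
  refine ⟨hU hσ.1, hσ.2.trans_le ?_⟩
  exact_mod_cast card_le_card (inter_subset_inter_left hU)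

lemma notMem_highDegreeOrderings_succ {v : V} {D : ℝ} {s : Fin n} {σ : Fin n ≃ V}
    (h : σ s ∈ G.neighborFinset v ∩ greedyU G σ (s + 1)) :
    σ ∉ highDegreeOrderings G n v D (s + 1) := by
  rw [mem_highDegreeOrderings]
  rintro ⟨hv, -⟩
  rw [mem_inter, SimpleGraph.mem_neighborFinset] at h
  rw [greedyU_succ, if_pos h.2] at hv
  simp [closedNbhd, h.1.symm] at hv

lemma greedyU_swap_trans (σ : Fin n ≃ V) {s j : Fin n} (hj : s ≤ j) :
    greedyU G ((Equiv.swap s j).trans σ) (s + 1) = greedyU G σ (s + 1) := by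
  refine greedyU_congr G fun i hi => ?_
  have h₁ : i ≠ s := by rintro rfl; omega
  have h₂ : i ≠ j := by rintro rfl; exact absurd hj (not_le.mpr hi)
  simp [Equiv.swap_apply_of_ne_of_ne h₁ h₂]

lemma swap_trans_mem_highDegreeOrderings {v : V} {D : ℝ} (σ : Fin n ≃ V) {s j : Fin n}
    (hj : s ≤ j) :
    (Equiv.swap s j).trans σ ∈ highDegreeOrderings G n v D s ↔
      σ ∈ highDegreeOrderings G n v D s := by
  simp only [mem_highDegreeOrderings, greedyU_swap_trans G σ hj]

/-- Exchanging the `s`-th vertex with a uniformly chosen unprocessed one shows that step `s`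
destroys at least a `D / n` fraction of the orderings in which `v` has residual degree above `D`. -/
lemma mul_card_highDegreeOrderings_le (v : V) (D : ℝ) (s : Fin n) :
    D * (highDegreeOrderings G n v D s).card ≤
      n * (highDegreeOrderings G n v D s \ highDegreeOrderings G n v D (s + 1)).card := by
  set B := highDegreeOrderings G n v D s with hB
  set B' := highDegreeOrderings G n v D (s + 1) with hB'
  let P : (Fin n ≃ V) → Fin n → Prop := fun σ j => s ≤ j ∧ (Equiv.swap s j).trans σ ∉ B'
  have hrow : ∀ σ ∈ B, D ≤ ((univ.filter (P σ)).card : ℝ) := by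
    intro σ hσ
    have hD := ((mem_highDegreeOrderings G).1 hσ).2
    refine hD.le.trans ?_
    have hsub : (G.neighborFinset v ∩ greedyU G σ (s + 1)).map σ.symm.toEmbedding ⊆
        univ.filter (P σ) := by
      intro j hj
      obtain ⟨w, hw, rfl⟩ := mem_map.1 hj
      have hle : s ≤ σ.symm w := by
        by_contra hlt
        have := apply_notMem_greedyU G σ s.2.le (σ.symm w) (not_le.1 hlt)
        exact this (by simpa using (mem_inter.1 hw).2)
      refine mem_filter.2 ⟨mem_univ _, hle, notMem_highDegreeOrderings_succ G ?_⟩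
      have := greedyU_swap_trans G σ hle
      simp only [Equiv.toEmbedding_apply] at *
      rw [this]
      simpa using hw
    have := card_le_card hsub
    rw [card_map] at this
    exact_mod_cast this
  have hcol : ∀ j : Fin n, (B.filter fun σ => P σ j).card ≤ (B \ B').card := by
    intro j
    refine card_le_card_of_injOn (fun σ => (Equiv.swap s j).trans σ) ?_ ?_
    · intro σ hσ
      simp only [coe_filter, Set.mem_ofPred_eq, P] at hσ
      simp only [coe_sdiff, Set.mem_sdiff, mem_coe]
      exact ⟨(swap_trans_mem_highDegreeOrderings G σ hσ.2.1).2 hσ.1, hσ.2.2⟩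
    · intro σ _ τ _ h
      exact Equiv.ext fun x => by simpa using Equiv.congr_fun h (Equiv.swap s j x)
  have hcount : ∑ σ ∈ B, (univ.filter (P σ)).card = ∑ j : Fin n, (B.filter fun σ => P σ j).card :=
    sum_card_bipartiteAbove_eq_sum_card_bipartiteBelow P
  calc D * B.card = ∑ σ ∈ B, D := by simp [mul_comm]
    _ ≤ ∑ σ ∈ B, ((univ.filter (P σ)).card : ℝ) := sum_le_sum hrow
    _ = ∑ j : Fin n, ((B.filter fun σ => P σ j).card : ℝ) := by exact_mod_cast hcount
    _ ≤ ∑ _j : Fin n, ((B \ B').card : ℝ) := sum_le_sum fun j _ => by exact_mod_cast hcol j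
    _ = n * (B \ B').card := by simp

lemma card_highDegreeOrderings_le (v : V) (D : ℝ) {s : ℕ} (hs : s ≤ n) :
    ((highDegreeOrderings G n v D s).card : ℝ) ≤
      Real.exp (-(D / n) * s) * Fintype.card (Fin n ≃ V) := by
  induction s with
  | zero => simpa using card_le_univ (highDegreeOrderings G n v D 0)
  | succ s ih =>
    have hn : (0 : ℝ) < n := by exact_mod_cast (by omega : 0 < n)
    have hsub := highDegreeOrderings_succ_subset G v D ⟨s, hs⟩
    have hmul := mul_card_highDegreeOrderings_le G v D ⟨s, hs⟩
    have hdiff := card_sdiff_add_card_eq_card hsub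
    simp only at hmul hdiff
    set b := ((highDegreeOrderings G n v D s).card : ℝ) with hb
    have hdiff' : ((highDegreeOrderings G n v D s \ highDegreeOrderings G n v D (s + 1)).card : ℝ)
        + (highDegreeOrderings G n v D (s + 1)).card = b := by
      rw [hb]
      exact_mod_cast hdiff
    have hstep : ((highDegreeOrderings G n v D (s + 1)).card : ℝ) ≤ (1 - D / n) * b := by
      have : D / n * b ≤
          (highDegreeOrderings G n v D s \ highDegreeOrderings G n v D (s + 1)).card := by
        rw [div_mul_eq_mul_div, div_le_iff₀ hn]
        linarith
      linarith
    calc ((highDegreeOrderings G n v D (s + 1)).card : ℝ) ≤ (1 - D / n) * b := hstep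
      _ ≤ Real.exp (-(D / n)) * b := by
          gcongr
          linarith [Real.add_one_le_exp (-(D / n))]
      _ ≤ Real.exp (-(D / n)) * (Real.exp (-(D / n) * s) * Fintype.card (Fin n ≃ V)) := by
          gcongr
          exact ih (by omega)
      _ = Real.exp (-(D / n) * (s + 1 : ℕ)) * Fintype.card (Fin n ≃ V) := by
          rw [← mul_assoc, ← Real.exp_add]
          congr 2
          push_cast
          ring

/-- Orderings for which the residual maximum degree after `t` steps is at most `9 n ln n / t`,
for all `t`, form all but an `n ^ (-7)` fraction. -/
lemma card_exists_lt_maxDegOn_greedyU_le (hn : 0 < n) (hcard : Fintype.card V = n) :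
    ((univ.filter fun σ : Fin n ≃ V => ∃ t, 1 ≤ t ∧ t ≤ n ∧
        9 * n * Real.log n / t < (maxDegOn G (greedyU G σ (t + 1)) : ℝ)).card : ℝ) ≤
      (n : ℝ) ^ (-7 : ℤ) * Fintype.card (Fin n ≃ V) := by
  have hn' : (0 : ℝ) < n := by exact_mod_cast hn
  let B : ℕ × V → Finset (Fin n ≃ V) := fun p =>
    highDegreeOrderings G n p.2 (9 * n * Real.log n / p.1) p.1
  have hB : ∀ p ∈ Icc 1 n ×ˢ (univ : Finset V),
      ((B p).card : ℝ) ≤ (n : ℝ) ^ (-9 : ℤ) * Fintype.card (Fin n ≃ V) := by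
    intro p hp
    simp only [mem_product, mem_Icc] at hp
    refine (card_highDegreeOrderings_le G _ _ hp.1.2).trans (le_of_eq ?_)
    have hp0 : (p.1 : ℝ) ≠ 0 := by
      have := hp.1.1
      positivity
    have : -(9 * n * Real.log n / p.1 / n) * (p.1 : ℝ) = Real.log n * (-9 : ℤ) := by
      field_simp
      push_cast
      ring
    rw [this, Real.exp_mul, Real.exp_log hn', Real.rpow_intCast]
  have hsub : (univ.filter fun σ : Fin n ≃ V => ∃ t, 1 ≤ t ∧ t ≤ n ∧
      9 * n * Real.log n / t < (maxDegOn G (greedyU G σ (t + 1)) : ℝ)) ⊆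
      (Icc 1 n ×ˢ (univ : Finset V)).biUnion B := by
    intro σ hσ
    obtain ⟨t, ht₁, ht₂, ht⟩ := (mem_filter.1 hσ).2
    have hpos : 0 ≤ 9 * n * Real.log n / t := by
      have := Real.log_natCast_nonneg n
      positivity
    have hne : (greedyU G σ (t + 1)).Nonempty := by
      by_contra hempty
      rw [not_nonempty_iff_eq_empty] at hempty
      rw [hempty] at ht
      simp only [maxDegOn, sup_empty, Nat.bot_eq_zero, Nat.cast_zero] at ht
      linarith
    obtain ⟨v, hv, hmax⟩ := exists_mem_eq_sup _ hne
      fun v => (G.neighborFinset v ∩ greedyU G σ (t + 1)).card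
    refine mem_biUnion.2 ⟨(t, v), by simp [ht₁, ht₂], (mem_highDegreeOrderings G).2 ⟨hv, ?_⟩⟩
    rw [maxDegOn, hmax] at ht
    exact ht
  calc _ ≤ (((Icc 1 n ×ˢ (univ : Finset V)).biUnion B).card : ℝ) := by
        exact_mod_cast card_le_card hsub
    _ ≤ ∑ p ∈ Icc 1 n ×ˢ (univ : Finset V), ((B p).card : ℝ) := by exact_mod_cast card_biUnion_le
    _ ≤ ∑ _p ∈ Icc 1 n ×ˢ (univ : Finset V),
          (n : ℝ) ^ (-9 : ℤ) * Fintype.card (Fin n ≃ V) := sum_le_sum hB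
    _ = (n : ℝ) ^ (-7 : ℤ) * Fintype.card (Fin n ≃ V) := by
        rw [sum_const, card_product, card_univ, hcard, Nat.card_Icc, Nat.add_sub_cancel,
          nsmul_eq_mul, ← mul_assoc]
        congr 1
        push_cast
        rw [show (-7 : ℤ) = 1 + 1 + -9 by norm_num, zpow_add₀ hn'.ne', zpow_add₀ hn'.ne', zpow_one]

/-- One block reduces the residual maximum degree to about its square root. -/
lemma blockDelta_succ_le {σ : Fin n ≃ V} (hn : 3 ≤ n)
    (hσ : ∀ t, 1 ≤ t → t ≤ n →
      (maxDegOn G (greedyU G σ (t + 1)) : ℝ) ≤ 9 * n * Real.log n / t)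
    {j : ℕ} (hj : Real.log n ^ 4 < blockDelta G σ (j + 1)) :
    (blockDelta G σ (j + 2) : ℝ) ≤ 45 * Real.log n * Real.sqrt (blockDelta G σ (j + 1)) := by
  have hn' : (0 : ℝ) < n := by exact_mod_cast (by omega : 0 < n)
  have hlog : 0 ≤ Real.log n := Real.log_natCast_nonneg n
  set D := blockDelta G σ (j + 1) with hD
  have hD1 : 1 ≤ D := by
    have : (0 : ℝ) < D := lt_of_le_of_lt (by positivity) hj
    exact_mod_cast this
  have hs : 1 ≤ Real.sqrt D := Real.one_le_sqrt.2 (by exact_mod_cast hD1)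
  have hk : blockK G σ (j + 1) = ⌈(n : ℝ) / (5 * Real.sqrt D)⌉₊ := by
    rw [blockK]
    exact if_pos hj
  set k := blockK G σ (j + 1) with hkdef
  have hk_ge : (n : ℝ) / (5 * Real.sqrt D) ≤ k := by
    rw [hk]
    exact Nat.le_ceil _
  have hk0 : (0 : ℝ) < n / (5 * Real.sqrt D) := by positivity
  have hk1 : 1 ≤ k := by exact_mod_cast hk0.trans_le hk_ge
  have hkn : k ≤ n := by
    rw [hk]
    refine Nat.ceil_le.2 (div_le_self hn'.le ?_)
    linarith
  calc (blockDelta G σ (j + 2) : ℝ) ≤ 9 * n * Real.log n / k := hσ k hk1 hkn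
    _ ≤ 9 * n * Real.log n / (n / (5 * Real.sqrt D)) := by gcongr
    _ = 45 * Real.log n * Real.sqrt D := by
        field_simp
        ring

end GreedyProcess

lemma le_two_pow_two_pow_ceil_logb_logb {x : ℝ} (hx : 1 < x) :
    x ≤ 2 ^ 2 ^ ⌈Real.logb 2 (Real.logb 2 x)⌉₊ := by
  have h := Nat.le_ceil (Real.logb 2 (Real.logb 2 x))
  rw [Real.logb_le_iff_le_rpow one_lt_two (Real.logb_pos one_lt_two hx),
    Real.logb_le_iff_le_rpow one_lt_two (by linarith), Real.rpow_natCast] at h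
  exact_mod_cast h

lemma div_sq_pow_two_pow_succ_le {A x y : ℝ} (hA : 0 < A) (hx : 0 ≤ x) (hy : 0 ≤ y)
    (h : y ≤ A * Real.sqrt x) (j : ℕ) :
    (y / A ^ 2) ^ 2 ^ (j + 1) ≤ (x / A ^ 2) ^ 2 ^ j := by
  rw [pow_succ' 2 j, pow_mul]
  refine pow_le_pow_left₀ (by positivity) ?_ _
  rw [div_pow, div_le_div_iff₀ (by positivity) (by positivity)]
  have hsq : y ^ 2 ≤ A ^ 2 * x := by
    calc y ^ 2 ≤ (A * Real.sqrt x) ^ 2 := pow_le_pow_left₀ hy h 2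
      _ = A ^ 2 * x := by rw [mul_pow, Real.sq_sqrt hx]
  calc y ^ 2 * A ^ 2 ≤ (A ^ 2 * x) * A ^ 2 := by gcongr
    _ = x * (A ^ 2) ^ 2 := by ring

/-- **Poly-logarithmic residual degree after `O(log log Δ)` blocks.** With
probability at least `1 - n ^ (-7)` over a uniformly random ordering, there is a
block index `i ≤ ⌈log₂ log₂ Δ⌉ + 2` with
`Δ_i ≤ max (5000 · (ln n)²) ((ln n)⁴)`. -/
theorem polylog_residual_degree_after_loglog_blocks
    {V : Type*} [Fintype V] [DecidableEq V] {n : ℕ} (hn : 3 ≤ n)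
    (hcard : Fintype.card V = n)
    (G : SimpleGraph V) [DecidableRel G.Adj]
    (hΔ : 4 ≤ maxDegOn G Finset.univ) :
    (1 - (n : ℝ) ^ (-7 : ℤ)) * (Fintype.card (Fin n ≃ V) : ℝ) ≤
      ((Finset.univ.filter (fun σ : Fin n ≃ V =>
        ∃ i, 1 ≤ i ∧
          i ≤ ⌈Real.logb 2 (Real.logb 2 (maxDegOn G Finset.univ : ℝ))⌉₊ + 2 ∧
          (blockDelta G σ i : ℝ) ≤
            max (5000 * (Real.log n) ^ 2) ((Real.log n) ^ 4))).card : ℝ) := by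
  have hn0 : 0 < n := by omega
  have hlog : 1 ≤ Real.log n := by
    rw [Real.le_log_iff_exp_le (by exact_mod_cast hn0)]
    have : (3 : ℝ) ≤ n := by exact_mod_cast hn
    linarith [Real.exp_one_lt_d9]
  have hbad := card_exists_lt_maxDegOn_greedyU_le G hn0 hcard
  set bad := univ.filter fun σ : Fin n ≃ V => ∃ t, 1 ≤ t ∧ t ≤ n ∧
    9 * n * Real.log n / t < (maxDegOn G (greedyU G σ (t + 1)) : ℝ) with hbad_def
  have hcompl : (badᶜ.card : ℝ) + bad.card = Fintype.card (Fin n ≃ V) := by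
    exact_mod_cast card_compl_add_card bad
  have key : (1 - (n : ℝ) ^ (-7 : ℤ)) * (Fintype.card (Fin n ≃ V) : ℝ) ≤ (badᶜ.card : ℝ) := by
    linarith
  refine key.trans ?_
  norm_cast
  refine card_le_card fun σ hσ => mem_filter.2 ⟨mem_univ _, ?_⟩
  have hgood : ∀ t, 1 ≤ t → t ≤ n →
      (maxDegOn G (greedyU G σ (t + 1)) : ℝ) ≤ 9 * n * Real.log n / t := by
    simpa [hbad_def] using hσ
  set Δ := maxDegOn G univ with hΔ_def
  set m := ⌈Real.logb 2 (Real.logb 2 (Δ : ℝ))⌉₊ with hm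
  have hΔ' : (4 : ℝ) ≤ Δ := by exact_mod_cast hΔ
  by_contra! hlarge
  set A := 45 * Real.log n with hA
  have hA1 : 1 ≤ A := by linarith
  have hpow : ∀ j ≤ m, ((blockDelta G σ (j + 1) : ℝ) / A ^ 2) ^ 2 ^ j ≤ Δ := by
    intro j
    induction j with
    | zero =>
      intro _
      have h₀ : blockDelta G σ (0 + 1) = Δ := rfl
      rw [h₀, pow_zero, pow_one]
      exact div_le_self (by positivity) (one_le_pow₀ hA1)
    | succ j ih =>
      intro hj
      have hbig := (le_max_right _ _).trans_lt (hlarge (j + 1) (by omega) (by omega))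
      have hstep := blockDelta_succ_le G hn hgood hbig
      exact (div_sq_pow_two_pow_succ_le (by linarith) (Nat.cast_nonneg _) (Nat.cast_nonneg _)
        hstep j).trans (ih (by omega))
  have hle : (blockDelta G σ (m + 1) : ℝ) / A ^ 2 ≤ 2 :=
    le_of_pow_le_pow_left₀ (by positivity) (by norm_num)
      ((hpow m le_rfl).trans (le_two_pow_two_pow_ceil_logb_logb (by linarith)))
  rw [div_le_iff₀ (by positivity)] at hle
  have hlast := (le_max_left _ _).trans_lt (hlarge (m + 1) (by omega) (by omega))
  nlinarith
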